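/- Let (Ω₁, 𝓕₁, P₁) and (Ω₂, 𝓕₂, P₂) be probability spaces and let B_1, …, B_d be measurable subsets of Ω₁ × Ω₂ (with the product σ-algebra) that are pairwise disjoint and whose union is Ω₁ × Ω₂. Then there exists a probability measure Q₁ on Ω₁, finitely supported with at most d atoms, such that (Q₁ ⊗ P₂)(B_k) = (P₁ ⊗ P₂)(B_k) for every k = 1, …, d. (This is the single-coordinate discretization step in the proof of Lemma ctf_cp3: the first factor of a product probability measure can be replaced by a discrete measure with at most d states while preserving the probabilities of all d cells of a measurable partition.) -/

import Mathlib

open MeasureTheory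
open scoped ENNReal

/-- A measure `Q` is *finitely supported with at most `d` atoms* if it is a convex
combination of at most `d` Dirac measures. -/
def FinitelySupportedWith {Ω : Type*} [MeasurableSpace Ω] (Q : Measure Ω) (d : ℕ) : Prop :=
  ∃ (u : Fin d → Ω) (w : Fin d → ℝ≥0∞),
    (∑ k, w k = 1) ∧ Q = ∑ k, w k • Measure.dirac (u k)

/-- In finite dimension a point outside a nonempty convex set is weakly separated from it, with no
topological assumption on the set. -/
theorem Convex.exists_ne_zero_forall_le_of_notMem {E : Type*} [NormedAddCommGroup E]
    [NormedSpace ℝ E] [FiniteDimensional ℝ E] {s : Set E} (hs : Convex ℝ s)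
    (hne : s.Nonempty) {x : E} (hx : x ∉ s) : ∃ l : E →L[ℝ] ℝ, l ≠ 0 ∧ ∀ y ∈ s, l y ≤ l x := by
  by_cases hint : (interior s).Nonempty
  · exact geometric_hahn_banach_of_nonempty_interior_point hs (fun h => hx (interior_subset h)) hint
  · obtain ⟨y₀, hy₀⟩ := hne
    rw [hs.interior_nonempty_iff_affineSpan_eq_top] at hint
    have hdir : vectorSpan ℝ s ≠ ⊤ := fun h => hint <|
      (AffineSubspace.affineSpan_eq_top_iff_vectorSpan_eq_top_of_nonempty ℝ E E ⟨y₀, hy₀⟩).2 h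
    obtain ⟨f, hf0, hf⟩ := Submodule.exists_le_ker_of_lt_top _ hdir.lt_top
    have hconst : ∀ y ∈ s, f y = f y₀ := fun y hy => by
      have := hf (vsub_mem_vectorSpan ℝ hy hy₀)
      simpa [sub_eq_zero] using this
    have hl0 : LinearMap.toContinuousLinearMap f ≠ 0 := by simpa using hf0
    rcases le_total (f y₀) (f x) with h | h
    · exact ⟨LinearMap.toContinuousLinearMap f, hl0, fun y hy => by simpa [hconst y hy] using h⟩
    · exact ⟨-LinearMap.toContinuousLinearMap f, neg_ne_zero.2 hl0,
        fun y hy => by simpa [hconst y hy] using h⟩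

/-- In finite dimension, the mean of an integrable function with values in a convex set lies in
that set, even if the set is not closed. -/
theorem Convex.integral_mem_of_finiteDimensional {Ω E : Type*} [MeasurableSpace Ω]
    {μ : Measure Ω} [IsProbabilityMeasure μ] [NormedAddCommGroup E] [NormedSpace ℝ E]
    [FiniteDimensional ℝ E] {s : Set E} (hs : Convex ℝ s) {f : Ω → E}
    (hf : Integrable f μ) (hfs : ∀ᵐ ω ∂μ, f ω ∈ s) : ∫ ω, f ω ∂μ ∈ s := by
  induction hn : Module.finrank ℝ E using Nat.strong_induction_on generalizing E with
  | _ n ih =>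
    by_contra hm
    have : CompleteSpace E := FiniteDimensional.complete ℝ E
    set m := ∫ ω, f ω ∂μ with hm_def
    obtain ⟨l, hl0, hl⟩ := hs.exists_ne_zero_forall_le_of_notMem
      (hfs.exists.imp' f fun _ h => h) hm
    have hint : Integrable (fun ω => l m - l (f ω)) μ :=
      (integrable_const _).sub (l.integrable_comp hf)
    have hzero : ∫ ω, (l m - l (f ω)) ∂μ = 0 := by
      rw [integral_sub (integrable_const _) (l.integrable_comp hf), l.integral_comp_comm hf]
      simp [hm_def]
    have hae : ∀ᵐ ω ∂μ, f ω - m ∈ l.ker := by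
      have h0 : 0 ≤ᵐ[μ] fun ω => l m - l (f ω) := by
        filter_upwards [hfs] with ω hω
        exact sub_nonneg.2 (hl _ hω)
      filter_upwards [(integral_eq_zero_iff_of_nonneg_ae h0 hint).1 hzero] with ω hω
      have hω' : l m - l (f ω) = 0 := hω
      simp only [LinearMap.mem_ker, map_sub]
      change l (f ω) - l m = 0
      linarith
    have hker : l.ker ≠ ⊤ := fun h => hl0 <| by
      ext v
      have hv : v ∈ l.ker := h ▸ Submodule.mem_top
      simpa using hv
    obtain ⟨p, hp⟩ := Submodule.ClosedComplemented.of_finiteDimensional (𝕜 := ℝ) l.ker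
    have hg : Integrable (fun ω => f ω - m) μ := hf.sub (integrable_const _)
    have hcompl : CompleteSpace l.ker := FiniteDimensional.complete ℝ _
    have key := ih _ (hn ▸ Submodule.finrank_lt hker)
      (s := {v : l.ker | (v : E) + m ∈ s})
      (f := fun ω => p (f ω - m))
      (by
        have := (hs.translate_preimage_left m).linear_preimage l.ker.subtype
        exact this)
      (p.integrable_comp hg)
      (by
        filter_upwards [hfs, hae] with ω h₁ h₂
        have h₃ : p (f ω - m) = ⟨f ω - m, h₂⟩ := hp ⟨f ω - m, h₂⟩
        simpa [h₃] using h₁) rfl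
    rw [p.integral_comp_comm hg, integral_sub hf (integrable_const _)] at key
    apply hm
    simpa [← hm_def] using key

/-- Affinely independent points of the hyperplane `l = 1` are linearly independent. -/
theorem AffineIndependent.linearIndependent_of_forall_eq_one {ι 𝕜 V : Type*} [Field 𝕜]
    [AddCommGroup V] [Module 𝕜 V] {z : ι → V} (hz : AffineIndependent 𝕜 z) (l : V →ₗ[𝕜] 𝕜)
    (hl : ∀ i, l (z i) = 1) : LinearIndependent 𝕜 z := by
  rw [linearIndependent_iff']
  intro t c hc
  refine affineIndependent_iff.1 hz t c ?_ hc
  simpa [hl] using congrArg l hc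

/-- A convex combination of at most `d` points can be written as one of exactly `d` points. -/
theorem exists_fin_weights_of_card_le {ι Ω : Type*} [Fintype ι] [Nonempty Ω] {d : ℕ}
    (hcard : Fintype.card ι ≤ d) (x : ι → Ω) (w : ι → ℝ) (hw : ∀ i, 0 ≤ w i) :
    ∃ (u : Fin d → Ω) (v : Fin d → ℝ), (∀ k, 0 ≤ v k) ∧
      ∀ g : Ω → ℝ, ∑ k, v k * g (u k) = ∑ i, w i * g (x i) := by
  obtain ⟨e⟩ : Nonempty (ι ↪ Fin d) :=
    Function.Embedding.nonempty_of_card_le (by simpa using hcard)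
  refine ⟨Function.extend e x fun _ => Classical.arbitrary Ω, Function.extend e w 0,
    fun k => ?_, fun g => ?_⟩
  · by_cases hk : ∃ i, e i = k
    · obtain ⟨i, rfl⟩ := hk
      simpa [e.injective.extend_apply] using hw i
    · simp [Function.extend_apply' _ _ _ hk]
  · symm
    refine Fintype.sum_of_injective e e.injective _ _ (fun k hk => ?_) (fun i => ?_)
    · rw [Function.extend_apply' w _ _ hk]
      simp
    · simp [e.injective.extend_apply]

/-- **single-coordinate discretization.**  Given probability spaces
`(Ω₁, P₁)` and `(Ω₂, P₂)` and a finite measurable partition `B 1, …, B d` of `Ω₁ × Ω₂`,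
the first factor `P₁` may be replaced by a finitely supported probability measure `Q₁`
with at most `d` atoms while preserving the probability of every partition cell. -/
theorem first_factor_discretization
    {Ω₁ Ω₂ : Type*} [MeasurableSpace Ω₁] [MeasurableSpace Ω₂]
    (P₁ : Measure Ω₁) (P₂ : Measure Ω₂)
    [IsProbabilityMeasure P₁] [IsProbabilityMeasure P₂]
    {d : ℕ} (B : Fin d → Set (Ω₁ × Ω₂))
    (hBmeas : ∀ k, MeasurableSet (B k))
    (hBdisj : Pairwise (Function.onFun Disjoint B))
    (hBunion : (⋃ k, B k) = Set.univ) :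
    ∃ Q₁ : Measure Ω₁,
      IsProbabilityMeasure Q₁ ∧
      FinitelySupportedWith Q₁ d ∧
      ∀ k, (Q₁.prod P₂) (B k) = (P₁.prod P₂) (B k) := by
  have hΩ₁ : Nonempty Ω₁ := nonempty_of_isProbabilityMeasure P₁
  let f : Ω₁ → Fin d → ℝ := fun ω k => P₂.real (Prod.mk ω ⁻¹' B k)
  have hslice : ∀ ω k, MeasurableSet (Prod.mk ω ⁻¹' B k) := fun ω k =>
    measurable_prodMk_left (hBmeas k)
  have hfk : ∀ k, Measurable fun ω => f ω k := fun k =>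
    (measurable_measure_prodMk_left (hBmeas k)).ennreal_toReal
  have hfk_int : ∀ k, Integrable (fun ω => f ω k) P₁ := fun k =>
    Integrable.of_bound (hfk k).aestronglyMeasurable 1 <| ae_of_all _ fun ω => by
      simp [f, abs_of_nonneg measureReal_nonneg]
  have hf_int : Integrable f P₁ := Integrable.of_eval hfk_int
  have hf_sum : ∀ ω, ∑ k, f ω k = 1 := fun ω => by
    have hdisj : Pairwise (Function.onFun Disjoint fun k => Prod.mk ω ⁻¹' B k) :=
      fun i j hij => (hBdisj hij).preimage _
    have h := measureReal_iUnion_fintype (μ := P₂) hdisj (hslice ω)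
    rw [← Set.preimage_iUnion, hBunion] at h
    simpa using h.symm
  have hmean : ∫ ω, f ω ∂P₁ ∈ convexHull ℝ (Set.range f) :=
    (convex_convexHull ℝ _).integral_mem_of_finiteDimensional hf_int <|
      ae_of_all _ fun ω => subset_convexHull ℝ _ ⟨ω, rfl⟩
  obtain ⟨ι, _, z, w, hz, hz_ind, hw_pos, hw_sum, hw_mean⟩ :=
    eq_pos_convex_span_of_mem_convexHull hmean
  choose x hx using fun i => hz ⟨i, rfl⟩
  have hcard : Fintype.card ι ≤ d := by
    have hlin := hz_ind.linearIndependent_of_forall_eq_one (∑ k, LinearMap.proj k)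
      (fun i => by simpa [← hx i] using hf_sum (x i))
    simpa using hlin.fintype_card_le_finrank
  obtain ⟨u, v, hv, huv⟩ := exists_fin_weights_of_card_le hcard x w fun i => (hw_pos i).le
  have hv_sum : ∑ k, ENNReal.ofReal (v k) = 1 := by
    rw [← ENNReal.ofReal_sum_of_nonneg fun k _ => hv k]
    have := huv fun _ => 1
    simp only [mul_one, hw_sum] at this
    simp [this]
  refine ⟨∑ k, ENNReal.ofReal (v k) • Measure.dirac (u k), ⟨by simpa using hv_sum⟩,
    ⟨u, _, hv_sum, rfl⟩, fun k => ?_⟩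
  have hmeas := measurable_measure_prodMk_left (ν := P₂) (hBmeas k)
  have hk : ∑ j, v j * f (u j) k = ∫ ω, f ω k ∂P₁ := by
    rw [huv fun ω => f ω k, ← eval_integral hfk_int, ← hw_mean]
    simp [← hx]
  calc
    _ = ∑ j, ENNReal.ofReal (v j) * P₂ (Prod.mk (u j) ⁻¹' B k) := by
      rw [Measure.prod_apply (hBmeas k), lintegral_finsetSum_measure]
      simp [lintegral_smul_measure, lintegral_dirac' _ hmeas]
    _ = ENNReal.ofReal (∑ j, v j * f (u j) k) := by
      rw [ENNReal.ofReal_sum_of_nonneg fun j _ => mul_nonneg (hv j) measureReal_nonneg]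
      simp [ENNReal.ofReal_mul, hv]
    _ = (P₁.prod P₂) (B k) := by
      rw [hk, ofReal_integral_eq_lintegral_ofReal (hfk_int k)
        (ae_of_all _ fun ω => measureReal_nonneg), Measure.prod_apply (hBmeas k)]
      simp [f]
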